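/- Let F_N(x) = (number of eigenvalues λ of (1/2)A_N with λ < x, counted with algebraic multiplicity)/2^N. Then for all x ∈ [-1,1], lim_{N→∞} F_N(x) = 1 - f((1/π)·arccos x), where f is the Devil's staircase function f(y) = Σ_{k=1}^{∞} ⌊ky⌋/2^k for 0 ≤ y < 1, extended by f(y) = 0 for y < 0 and f(y) = 1 for y ≥ 1. -/

import Mathlib

open Matrix Polynomial

/-- `J_k = diag(1,0,...,0)` of order `2^k`. -/
noncomputable def Jmat (k : ℕ) : Matrix (Fin (2 ^ k)) (Fin (2 ^ k)) ℝ :=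
  Matrix.diagonal (fun i => if (i : ℕ) = 0 then 1 else 0)

/-- `J_k' = diag(0,...,0,1)` of order `2^k`. -/
noncomputable def Jmat' (k : ℕ) : Matrix (Fin (2 ^ k)) (Fin (2 ^ k)) ℝ :=
  Matrix.diagonal (fun i => if (i : ℕ) = 2 ^ k - 1 then 1 else 0)

/-- The equivalence identifying `Fin (2^k) ⊕ Fin (2^k)` with `Fin (2^(k+1))`. -/
def blockEquiv (k : ℕ) : Fin (2 ^ k) ⊕ Fin (2 ^ k) ≃ Fin (2 ^ (k + 1)) :=
  finSumFinEquiv.trans (finCongr (by rw [pow_succ, mul_two]))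

/-- The adjacency matrices `A_k`, defined recursively by `A_0 = (0)` and
`A_{k+1} = [[A_k, J_k], [J_k', A_k]]` in block form. -/
noncomputable def Amat : (k : ℕ) → Matrix (Fin (2 ^ k)) (Fin (2 ^ k)) ℝ
  | 0 => 0
  | (k + 1) => Matrix.reindex (blockEquiv k) (blockEquiv k)
      (Matrix.fromBlocks (Amat k) (Jmat k) (Jmat' k) (Amat k))

/-- `T_k = A_k - λ I`. -/
noncomputable def Tmat (k : ℕ) (l : ℝ) : Matrix (Fin (2 ^ k)) (Fin (2 ^ k)) ℝ :=
  Amat k - l • 1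

/-- Characteristic polynomial value `χ_k(λ) = det (A_k - λ I)`. -/
noncomputable def chiA (k : ℕ) (l : ℝ) : ℝ := (Tmat k l).det

/-- Submatrix obtained by deleting the top row and the rightmost column. -/
noncomputable def delTopRight {n : ℕ} (M : Matrix (Fin n) (Fin n) ℝ) :
    Matrix (Fin (n - 1)) (Fin (n - 1)) ℝ :=
  Matrix.of fun i j => M ⟨i.1 + 1, by have := i.isLt; omega⟩ ⟨j.1, by have := j.isLt; omega⟩

/-- Submatrix obtained by deleting the bottom row and the rightmost column. -/
noncomputable def delBotRight {n : ℕ} (M : Matrix (Fin n) (Fin n) ℝ) :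
    Matrix (Fin (n - 1)) (Fin (n - 1)) ℝ :=
  Matrix.of fun i j => M ⟨i.1, by have := i.isLt; omega⟩ ⟨j.1, by have := j.isLt; omega⟩

/-- `φ_k = det Q_k`, where `Q_k` is `T_k` with top row and right column deleted. -/
noncomputable def phiA (k : ℕ) (l : ℝ) : ℝ := (delTopRight (Tmat k l)).det

/-- `ψ_k = det P_k`, where `P_k` is `T_k` with bottom row and right column deleted. -/
noncomputable def psiA (k : ℕ) (l : ℝ) : ℝ := (delBotRight (Tmat k l)).det

open Filter

/-- The empirical spectral distribution of `(1/2) A_N`: the number of eigenvalues `λ < x`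
(real roots of the characteristic polynomial, counted with algebraic multiplicity),
divided by `2^N`. -/
noncomputable def specDist (N : ℕ) (x : ℝ) : ℝ :=
  (((((1 : ℝ) / 2) • Amat N).charpoly.roots.filter (fun r => r < x)).card : ℝ) / 2 ^ N

/-- The Devil's staircase function `f(y) = ∑_{k=1}^∞ ⌊ky⌋/2^k` on `[0,1)`, extended by
`f(y) = 0` for `y < 0` and `f(y) = 1` for `y ≥ 1`. -/
noncomputable def devilExt (y : ℝ) : ℝ :=
  if y < 0 then 0 else if 1 ≤ y then 1 else ∑' k : ℕ, (⌊(k : ℝ) * y⌋ : ℝ) / 2 ^ k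


section helpers
variable {m : Type*} [Fintype m] [DecidableEq m]

/-- The block matrix with rank-one off-diagonal corners. -/
noncomputable def Bm (T : Matrix m m ℝ) (a b : m) : Matrix (m ⊕ m) (m ⊕ m) ℝ :=
  Matrix.fromBlocks T (-Matrix.single a a 1) (-Matrix.single b b 1) T

lemma det_sub_single (T : Matrix m m ℝ) (a b : m) (h : ℝ) :
    (T - Matrix.single b a h).det = T.det - h * T.adjugate a b := by
  have : T - Matrix.single b a h = T.updateRow b (T b + (-h) • Pi.single a 1) := by
    ext i j
    by_cases hi : i = b
    · subst hi
      by_cases hj : j = a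
      · subst hj; simp; ring
      · simp [Matrix.single_apply, hj, Ne.symm hj]
    · simp [Matrix.single_apply, hi, Ne.symm hi]
  rw [this, Matrix.det_updateRow_add, Matrix.det_updateRow_smul, Matrix.adjugate_apply]
  simp; ring

lemma adj_eq (T : Matrix m m ℝ) (hT : T.det ≠ 0) (a b : m) :
    T.adjugate a b = T.det * T⁻¹ a b := by
  rw [Matrix.inv_def]
  simp [Ring.inverse_eq_inv', hT]

lemma det_Bm (T : Matrix m m ℝ) (hT : T.det ≠ 0) (a b : m) :
    (Bm T a b).det = T.det ^ 2 * (1 - T⁻¹ a b * T⁻¹ b a) := by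
  let _ : Invertible T := T.invertibleOfIsUnitDet (isUnit_iff_ne_zero.mpr hT)
  rw [Bm, Matrix.det_fromBlocks₁₁]
  have : -Matrix.single b b 1 * ⅟T * -Matrix.single a a (1:ℝ) = Matrix.single b a (T⁻¹ b a) := by
    rw [Matrix.invOf_eq_nonsing_inv]
    simp [Matrix.single_mul_mul_single]
  rw [this, det_sub_single, adj_eq T hT]
  ring

lemma inv_entry {n : Type*} [Fintype n] [DecidableEq n] (B : Matrix n n ℝ) (hB : B.det ≠ 0)
    (w : n → ℝ) (j : n) (h : B *ᵥ w = Pi.single j 1) (i : n) : B⁻¹ i j = w i := by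
  have : B⁻¹ *ᵥ (B *ᵥ w) = w := by
    rw [Matrix.mulVec_mulVec, Matrix.nonsing_inv_mul _ (isUnit_iff_ne_zero.mpr hB),
      Matrix.one_mulVec]
  rw [h] at this
  rw [← this]; simp

lemma mulVec_inv_col (T : Matrix m m ℝ) (hT : T.det ≠ 0) (a : m) :
    T *ᵥ (fun i => T⁻¹ i a) = Pi.single a 1 := by
  have : (fun i => T⁻¹ i a) = T⁻¹ *ᵥ Pi.single a 1 := by ext i; simp
  rw [this, Matrix.mulVec_mulVec, Matrix.mul_nonsing_inv _ (isUnit_iff_ne_zero.mpr hT),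
      Matrix.one_mulVec]

lemma Bm_col_a (T : Matrix m m ℝ) (hT : T.det ≠ 0) (a b : m) (s : ℝ)
    (hs : s * (1 - T⁻¹ a b * T⁻¹ b a) = 1) :
    Bm T a b *ᵥ (Sum.elim (s • fun i => T⁻¹ i a) ((s * T⁻¹ b a) • fun i => T⁻¹ i b))
      = Pi.single (Sum.inl a) 1 := by
  rw [Bm, Matrix.fromBlocks_mulVec]
  simp only [Sum.elim_comp_inl, Sum.elim_comp_inr, Matrix.mulVec_smul, mulVec_inv_col T hT,
    Matrix.neg_mulVec, Matrix.single_mulVec]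
  ext i
  rcases i with i | i
  · by_cases h : i = a
    · subst h; simp; linarith
    · simp [h]
  · by_cases h : i = b
    · subst h; simp
    · simp [h]

lemma Bm_col_b (T : Matrix m m ℝ) (hT : T.det ≠ 0) (a b : m) (s : ℝ)
    (hs : s * (1 - T⁻¹ a b * T⁻¹ b a) = 1) :
    Bm T a b *ᵥ (Sum.elim ((s * T⁻¹ a b) • fun i => T⁻¹ i a) (s • fun i => T⁻¹ i b))
      = Pi.single (Sum.inr b) 1 := by
  rw [Bm, Matrix.fromBlocks_mulVec]
  simp only [Sum.elim_comp_inl, Sum.elim_comp_inr, Matrix.mulVec_smul, mulVec_inv_col T hT,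
    Matrix.neg_mulVec, Matrix.single_mulVec]
  ext i
  rcases i with i | i
  · by_cases h : i = a
    · subst h; simp
    · simp [h]
  · by_cases h : i = b
    · subst h; simp; linarith
    · simp [h]

/-- The invariant carried by the recursion. -/
def InvR (T : Matrix m m ℝ) (a b : m) (c u v : ℝ) : Prop :=
  T.det = c * v ∧ T.det * T⁻¹ a a = c * u ∧ T.det * T⁻¹ b b = c * u ∧
    T.det ^ 2 * (T⁻¹ a b * T⁻¹ b a) = c ^ 2

lemma InvR.step {T : Matrix m m ℝ} {a b : m} {c u v w : ℝ} (h : InvR T a b c u v)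
    (hT : T.det ≠ 0) (hB : (Bm T a b).det ≠ 0) (hw : u * w = v ^ 2 - 1) :
    InvR (Bm T a b) (Sum.inl a) (Sum.inr b) (c ^ 2 * u) v w := by
  obtain ⟨h1, h2, h3, h4⟩ := h
  have hd := det_Bm T hT a b
  have hne : (1 - T⁻¹ a b * T⁻¹ b a) ≠ 0 := by
    intro h0; rw [h0] at hd; simp at hd; exact hB hd
  obtain ⟨s, hs⟩ : ∃ s, s * (1 - T⁻¹ a b * T⁻¹ b a) = 1 := ⟨_, inv_mul_cancel₀ hne⟩
  have ea := inv_entry _ hB _ _ (Bm_col_a T hT a b s hs)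
  have eb := inv_entry _ hB _ _ (Bm_col_b T hT a b s hs)
  have e1 := ea (Sum.inl a)
  have e2 := ea (Sum.inr b)
  have e3 := eb (Sum.inl a)
  have e4 := eb (Sum.inr b)
  simp only [Sum.elim_inl, Sum.elim_inr, Pi.smul_apply, smul_eq_mul] at e1 e2 e3 e4
  unfold InvR
  rw [e1, e2, e3, e4, hd]
  generalize T⁻¹ a b = x at *
  generalize T⁻¹ b a = y at *
  generalize T⁻¹ a a = p at *
  generalize T⁻¹ b b = q at *
  generalize T.det = d at *
  have hds : d ^ 2 * (1 - x * y) * s = d ^ 2 := by linear_combination d ^ 2 * hs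
  refine ⟨?_, ?_, ?_, ?_⟩
  · rw [mul_assoc, hw]; subst h1; linear_combination -h4
  · rw [← mul_assoc, hds]; linear_combination d * h2 + c * u * h1
  · rw [← mul_assoc, hds]; linear_combination d * h3 + c * u * h1
  · have : (d ^ 2 * (1 - x * y)) ^ 2 * (s * x * p * (s * y * q))
        = (d ^ 2 * (1 - x * y) * s) ^ 2 * (x * y * p * q) := by ring
    rw [this, hds]
    have : (d ^ 2) ^ 2 * (x * y * p * q) = (d ^ 2 * (x * y)) * (d * p) * (d * q) := by ring
    rw [this, h2, h3, h4]; ring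

lemma InvR.reindex {n : Type*} [Fintype n] [DecidableEq n] (e : m ≃ n) {T : Matrix m m ℝ}
    {a b : m} {c u v : ℝ} (h : InvR T a b c u v) :
    InvR (Matrix.reindex e e T) (e a) (e b) c u v := by
  unfold InvR at *
  rw [Matrix.det_reindex_self, Matrix.inv_reindex]
  simpa using h

end helpers

/-- `l I - A_k`. -/
noncomputable def Lm (k : ℕ) (l : ℝ) : Matrix (Fin (2 ^ k)) (Fin (2 ^ k)) ℝ :=
  Matrix.scalar _ l - Amat k

/-- first index -/
def fi (k : ℕ) : Fin (2 ^ k) := ⟨0, by positivity⟩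
/-- last index -/
def la (k : ℕ) : Fin (2 ^ k) := ⟨2 ^ k - 1, by have : 0 < 2 ^ k := by positivity
                                               omega⟩

lemma Jmat_eq (k : ℕ) : Jmat k = Matrix.single (fi k) (fi k) 1 := by
  ext i j
  by_cases h : i = j
  · subst h; simp only [Jmat, Matrix.diagonal_apply_eq, Matrix.single_apply, fi, Fin.ext_iff, and_self, eq_comm]
  · simp only [Jmat, Matrix.diagonal_apply_ne _ h, Matrix.single_apply]
    rw [if_neg]; rintro ⟨rfl, rfl⟩; exact h rfl

lemma Jmat'_eq (k : ℕ) : Jmat' k = Matrix.single (la k) (la k) 1 := by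
  ext i j
  by_cases h : i = j
  · subst h; simp only [Jmat', Matrix.diagonal_apply_eq, Matrix.single_apply, la, Fin.ext_iff, and_self, eq_comm]
  · simp only [Jmat', Matrix.diagonal_apply_ne _ h, Matrix.single_apply]
    rw [if_neg]; rintro ⟨rfl, rfl⟩; exact h rfl

lemma Lm_succ (k : ℕ) (l : ℝ) : Lm (k + 1) l =
    Matrix.reindex (blockEquiv k) (blockEquiv k) (Bm (Lm k l) (fi k) (la k)) := by
  rw [Lm, Amat, Bm, ← Jmat_eq, ← Jmat'_eq]
  ext i j
  obtain ⟨i, rfl⟩ := (blockEquiv k).surjective i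
  obtain ⟨j, rfl⟩ := (blockEquiv k).surjective j
  rcases i with i | i <;> rcases j with j | j <;>
    simp [Lm, Matrix.diagonal_apply]

lemma be_fi (k : ℕ) : blockEquiv k (Sum.inl (fi k)) = fi (k + 1) := by
  ext; simp [blockEquiv, fi]

lemma be_la (k : ℕ) : blockEquiv k (Sum.inr (la k)) = la (k + 1) := by
  ext; simp [blockEquiv, la, pow_succ]
  have : 0 < 2 ^ k := by positivity
  omega

/-- The polynomial factor of repeated roots. -/
noncomputable def cP : ℕ → ℝ[X]
  | 0 => 1
  | (k + 1) => cP k ^ 2 * Chebyshev.U ℝ (k : ℤ)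

lemma U_rel (n : ℕ) (x : ℝ) : (Chebyshev.U ℝ n).eval x * (Chebyshev.U ℝ (n + 2)).eval x
    = (Chebyshev.U ℝ (n + 1)).eval x ^ 2 - 1 := by
  · induction n with
    | zero => simp [Chebyshev.U_two]; ring
    | succ n ih =>
      have h1 := congrArg (eval x) (Chebyshev.U_add_two ℝ (n : ℤ))
      have h2 := congrArg (eval x) (Chebyshev.U_add_two ℝ ((n : ℤ) + 1))
      push_cast
      rw [show (n : ℤ) + 1 + 1 = n + 2 by ring] at *
      simp only [eval_sub, eval_mul, eval_X, eval_ofNat] at h1 h2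
      rw [h2]
      linear_combination ih - (eval x (Chebyshev.U ℝ ((n:ℤ) + 2))) * h1

lemma Inv_all (x : ℝ) (hg : ∀ k, (Lm k (2 * x)).det ≠ 0) (k : ℕ) :
    InvR (Lm k (2 * x)) (fi k) (la k) ((cP k).eval x)
      ((Chebyshev.U ℝ (k : ℤ)).eval x) ((Chebyshev.U ℝ ((k : ℤ) + 1)).eval x) := by
  induction k with
  | zero =>
    have : Subsingleton (Fin (2 ^ 0)) := inferInstanceAs (Subsingleton (Fin 1))
    have h0 : ∀ i j, Lm 0 (2 * x) i j = 2 * x := by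
      intro i j
      rw [Subsingleton.elim i j]
      simp [Lm, Amat]
    have hd : (Lm 0 (2 * x)).det = 2 * x := by
      rw [Matrix.det_eq_elem_of_subsingleton _ (fi 0), h0]
    have hx : 2 * x ≠ 0 := by rw [← hd]; exact hg 0
    have hi : ∀ i j, (Lm 0 (2 * x))⁻¹ i j = (2 * x)⁻¹ := by
      intro i j
      refine inv_entry _ (hg 0) (fun _ => (2 * x)⁻¹) j ?_ i
      ext i'
      rw [Subsingleton.elim i' j]
      simp [Matrix.mulVec, dotProduct, h0]
      rw [← _root_.mul_inv_rev, mul_inv_cancel₀ hx]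
    unfold InvR
    rw [hd]
    simp only [hi, cP]
    simp
    field_simp
    simp
    intro h; exact hx (by simp [h])
  | succ k ih =>
    have hB := hg (k + 1)
    rw [Lm_succ, Matrix.det_reindex_self] at hB
    have := (ih.step (hg k) hB (U_rel k x)).reindex (blockEquiv k)
    rw [be_fi, be_la, ← Lm_succ] at this
    simpa [cP, add_assoc, one_add_one_eq_two] using this

lemma charpoly_half (N : ℕ) : (((1 : ℝ) / 2) • Amat N).charpoly
    = C ((1 / 2 : ℝ) ^ (2 ^ N)) * (cP N * Chebyshev.U ℝ ((N + 1 : ℕ) : ℤ)) := by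
  have hev : ∀ k x, (Lm k x).det = (Amat k).charpoly.eval x := by
    intro k x; rw [Matrix.eval_charpoly]; rfl
  apply Polynomial.eq_of_infinite_eval_eq
  have hcount : (⋃ k : ℕ, {x : ℝ | (Lm k (2 * x)).det = 0}).Countable := by
    apply Set.countable_iUnion
    intro k
    apply Set.Finite.countable
    have : {x : ℝ | (Amat k).charpoly.eval x = 0}.Finite := by
      apply Set.Finite.subset ((Amat k).charpoly.roots.toFinset.finite_toSet)
      intro x hx
      simp [(Matrix.charpoly_monic (Amat k)).ne_zero]
      exact hx
    have h2 := this.preimage (f := fun x : ℝ => 2 * x) (by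
      intro x _ y _ h; simpa using h)
    refine h2.subset ?_
    intro x hx
    simp only [Set.mem_ofPred_eq, hev] at hx
    exact hx
  have hinf : (⋃ k : ℕ, {x : ℝ | (Lm k (2 * x)).det = 0})ᶜ.Infinite := by
    intro hf
    have := (hcount.union hf.countable)
    rw [Set.union_compl_self] at this
    exact Set.not_countable_univ this
  refine hinf.mono ?_
  intro x hx
  simp only [Set.mem_compl_iff, Set.mem_iUnion, Set.mem_ofPred_eq, not_exists] at hx
  have := (Inv_all x hx N).1
  simp only [Set.mem_ofPred_eq, eval_mul, eval_C]
  push_cast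
  rw [← this, Matrix.eval_charpoly]
  have e : (Matrix.scalar (Fin (2 ^ N))) x - (1 / 2 : ℝ) • Amat N
      = (1 / 2 : ℝ) • Lm N (2 * x) := by
    ext i j
    by_cases h : i = j
    · subst h; simp [Lm]; ring
    · simp [Lm, h]
  rw [e, Matrix.det_smul]
  simp

/-- number of roots below x -/
noncomputable def cnt (x : ℝ) (p : ℝ[X]) : ℕ := (p.roots.filter (fun r => r < x)).card

lemma cnt_mul (x : ℝ) (p q : ℝ[X]) (h : p * q ≠ 0) : cnt x (p * q) = cnt x p + cnt x q := by
  simp [cnt, Polynomial.roots_mul h]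

lemma U_ne (n : ℕ) : Chebyshev.U ℝ (n : ℤ) ≠ 0 := Chebyshev.U_ne_zero ℝ _ (by omega)

lemma cP_ne (n : ℕ) : cP n ≠ 0 := by
  induction n with
  | zero => simp [cP]
  | succ n ih => rw [cP]; exact mul_ne_zero (pow_ne_zero _ ih) (U_ne n)

lemma cnt_cP (x : ℝ) (n : ℕ) : (cnt x (cP n) : ℝ) / 2 ^ n
    = ∑ j ∈ Finset.range n, (cnt x (Chebyshev.U ℝ (j : ℤ)) : ℝ) / 2 ^ (j + 1) := by
  induction n with
  | zero => simp [cP, cnt]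
  | succ n ih =>
    have h : cnt x (cP (n + 1)) = 2 * cnt x (cP n) + cnt x (Chebyshev.U ℝ (n : ℤ)) := by
      have := cP_ne n
      rw [cP, cnt_mul _ _ _ (mul_ne_zero (pow_ne_zero _ this) (U_ne n)), sq,
        cnt_mul _ _ _ (mul_ne_zero this this)]
      ring
    rw [Finset.sum_range_succ, ← ih, h]
    push_cast
    rw [pow_succ]
    field_simp

lemma specDist_eq (N : ℕ) (x : ℝ) : specDist N x =
    (cnt x (Chebyshev.U ℝ ((N + 1 : ℕ) : ℤ)) : ℝ) / 2 ^ N +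
    ∑ j ∈ Finset.range N, (cnt x (Chebyshev.U ℝ (j : ℤ)) : ℝ) / 2 ^ (j + 1) := by
  have : specDist N x = (cnt x ((((1 : ℝ) / 2) • Amat N).charpoly) : ℝ) / 2 ^ N := rfl
  rw [this, charpoly_half, ← cnt_cP]
  have h1 : cnt x (C ((1 / 2 : ℝ) ^ (2 ^ N)) * (cP N * Chebyshev.U ℝ ((N + 1 : ℕ) : ℤ)))
      = cnt x (cP N * Chebyshev.U ℝ ((N + 1 : ℕ) : ℤ)) := by
    rw [cnt, Polynomial.roots_C_mul _ (by positivity)]; rfl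
  rw [h1, cnt_mul _ _ _ (mul_ne_zero (cP_ne N) (U_ne _))]
  push_cast; ring

lemma cnt_U (x : ℝ) (hx₁ : -1 ≤ x) (hx₂ : x ≤ 1) (n : ℕ) :
    cnt x (Chebyshev.U ℝ (n : ℤ)) = n - ⌊((n + 1 : ℕ) : ℝ) * (Real.arccos x / Real.pi)⌋₊ := by
  have hpi := Real.pi_pos
  have hnn := Real.arccos_nonneg x
  have hmap : (Chebyshev.U ℝ (n : ℤ)).roots =
      Multiset.map (fun k : ℕ => Real.cos ((k + 1) * Real.pi / (n + 1))) (Multiset.range n) := by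
    rw [Chebyshev.roots_U_real, Finset.image_val, Finset.range_val, Multiset.dedup_eq_self.mpr]
    exact Chebyshev.roots_U_real_nodup n
  rw [cnt, hmap, Multiset.filter_map, Multiset.card_map]
  set m := ⌊((n + 1 : ℕ) : ℝ) * (Real.arccos x / Real.pi)⌋₊ with hm
  have : Multiset.filter ((fun r => r < x) ∘ fun k : ℕ => Real.cos ((k + 1) * Real.pi / (n + 1)))
      (Multiset.range n) = (Finset.Ico m n).val := by
    have : Finset.Ico m n = (Finset.range n).filter (fun k => m ≤ k) := by
      ext k; simp [and_comm]
    rw [this, Finset.filter_val, Finset.range_val]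
    apply Multiset.filter_congr
    intro k hk
    rw [Multiset.mem_range] at hk
    have hk' : (k : ℝ) + 1 ≤ n := by exact_mod_cast hk
    have hn : (0 : ℝ) < n + 1 := by positivity
    have hlt : Real.cos ((k + 1) * Real.pi / (n + 1)) < x ↔
        Real.arccos x < (k + 1) * Real.pi / (n + 1) := by
      conv_lhs => rw [← Real.cos_arccos hx₁ hx₂]
      apply Real.strictAntiOn_cos.lt_iff_gt
      · refine ⟨by positivity, ?_⟩
        rw [div_le_iff₀ hn]; nlinarith
      · exact ⟨hnn, Real.arccos_le_pi x⟩
    simp only [Function.comp]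
    rw [hlt, hm, ← Nat.lt_succ_iff, Nat.floor_lt (by positivity)]
    push_cast
    rw [lt_div_iff₀ hn, mul_div_assoc', div_lt_iff₀ hpi, mul_comm]
  rw [this]
  simp

lemma sum_id (N : ℕ) : ((N + 1 : ℕ) : ℝ) / 2 ^ N +
    ∑ j ∈ Finset.range N, (j : ℝ) / 2 ^ (j + 1) = 1 := by
  induction N with
  | zero => simp
  | succ n ih =>
    rw [Finset.sum_range_succ, ← ih]
    push_cast
    rw [pow_succ]
    field_simp
    ring

lemma tendsto_aux : Tendsto (fun N : ℕ => ((N : ℝ) + 2) / 2 ^ N) atTop (nhds 0) := by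
  have h1 := tendsto_pow_const_div_const_pow_of_one_lt 1 (one_lt_two : (1:ℝ) < 2)
  have h2 := tendsto_pow_const_div_const_pow_of_one_lt 0 (one_lt_two : (1:ℝ) < 2)
  have := h1.add (h2.const_mul 2)
  simp only [mul_zero, add_zero] at this
  refine this.congr ?_
  intro N; simp; ring

/-- For all `x ∈ [-1,1]`, `F_N(x) → 1 - f(arccos x / π)` as `N → ∞`. -/
theorem specDist_tendsto_devil (x : ℝ) (hx₁ : -1 ≤ x) (hx₂ : x ≤ 1) :
    Tendsto (fun N => specDist N x) atTop
      (nhds (1 - devilExt (Real.arccos x / Real.pi))) := by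
  have hc := cnt_U x hx₁ hx₂
  have hpi := Real.pi_pos
  have hy0 : 0 ≤ Real.arccos x / Real.pi := div_nonneg (Real.arccos_nonneg x) hpi.le
  have hy1 : Real.arccos x / Real.pi ≤ 1 := (div_le_one hpi).mpr (Real.arccos_le_pi x)
  simp only [specDist_eq, hc]
  generalize Real.arccos x / Real.pi = y at *
  rcases eq_or_lt_of_le hy1 with rfl | hy
  · have hz : ∀ n : ℕ, n - ⌊((n + 1 : ℕ) : ℝ) * 1⌋₊ = 0 := by
      intro n; rw [mul_one, Nat.floor_natCast]; omega
    simp only [hz]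
    have h1 : ¬ ((1 : ℝ) < 0) := by norm_num
    simp [devilExt, h1]
  · rw [devilExt, if_neg (not_lt.mpr hy0), if_neg (not_le.mpr hy)]
    have hfl : ∀ n : ℕ, ((n - ⌊((n + 1 : ℕ) : ℝ) * y⌋₊ : ℕ) : ℝ)
        = n - (⌊((n + 1 : ℕ) : ℝ) * y⌋ : ℝ) := by
      intro n
      have hle : ⌊((n + 1 : ℕ) : ℝ) * y⌋₊ ≤ n := by
        rw [← Nat.lt_succ_iff, Nat.floor_lt (by positivity)]
        have : (0 : ℝ) < ((n + 1 : ℕ) : ℝ) := by positivity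
        exact mul_lt_of_lt_one_right this hy
      rw [Nat.cast_sub hle, natCast_floor_eq_intCast_floor (by positivity)]
    simp only [hfl]
    have hnn : ∀ k : ℕ, (0 : ℝ) ≤ (⌊(k : ℝ) * y⌋ : ℝ) := by
      intro k; exact_mod_cast Int.floor_nonneg.mpr (by positivity)
    have hub : ∀ k : ℕ, (⌊(k : ℝ) * y⌋ : ℝ) ≤ k := by
      intro k
      exact (Int.floor_le _).trans (mul_le_of_le_one_right (by positivity) hy1)
    have hsum : Summable (fun k : ℕ => (⌊(k : ℝ) * y⌋ : ℝ) / 2 ^ k) := by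
      have hg : Summable (fun k : ℕ => (k : ℝ) ^ 1 * (1 / 2 : ℝ) ^ k) :=
        summable_pow_mul_geometric_of_norm_lt_one 1 (by norm_num)
      refine Summable.of_nonneg_of_le (fun k => div_nonneg (hnn k) (by positivity)) ?_ hg
      intro k
      rw [pow_one, one_div, inv_pow, ← div_eq_mul_inv]
      gcongr
      exact hub k
    have ht := (hsum.hasSum.tendsto_sum_nat).comp (tendsto_add_atTop_nat 1)
    have h0 : Tendsto (fun N : ℕ => (⌊((N + 1 + 1 : ℕ) : ℝ) * y⌋ : ℝ) / 2 ^ N) atTop (nhds 0) := by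
      refine squeeze_zero (fun N => div_nonneg (hnn _) (by positivity)) ?_ tendsto_aux
      intro N
      gcongr
      refine (hub _).trans ?_
      push_cast; linarith
    have := (ht.const_sub 1).sub h0
    rw [sub_zero] at this
    refine this.congr ?_
    intro N
    rw [← sum_id N]
    simp only [Function.comp, Finset.sum_range_succ', sub_div, Finset.sum_sub_distrib]
    simp
    ring
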